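/- arXiv:1108.5223 — 7 statements merged into one kernel-verified Lean document; each statement's English description precedes it below -/
import Mathlib

section
/- Let 0 < α < 1, let k ≥ 1, and let f_1, …, f_k and g be C¹ diffeomorphisms of [0,1] (increasing C¹ bijections of [0,1] with everywhere positive derivative) such that f_i ∘ g = g ∘ f_i for every 1 ≤ i ≤ k. Suppose I ⊆ [0,1] is a nondegenerate closed subinterval with g(I) = I and with the restriction of g to I not equal to the identity. Suppose there is a sequence of indices i_1, i_2, i_3, … in {1,…,k} such that the series ∑_{j≥0} |f_{i_j} ∘ ⋯ ∘ f_{i_1}(I)|^α converges (the j = 0 term being |I|^α, and |J| denoting the length of an interval J). Then it is impossible that every f_m (1 ≤ m ≤ k) has an α-Hölder continuous derivative, i.e. the maps f_1, …, f_k cannot all be of class C^{1+α}. -/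
open Set

/-- A `C¹` diffeomorphism of `[0,1]`: an increasing `C¹` bijection of `[0,1]`
onto itself with everywhere positive derivative (the derivative being `f'`). -/
def IsC1DiffeoWithDeriv (f f' : ℝ → ℝ) : Prop :=
  Set.BijOn f (Set.Icc 0 1) (Set.Icc 0 1) ∧
  StrictMonoOn f (Set.Icc 0 1) ∧
  (∀ x ∈ Set.Icc (0:ℝ) 1, HasDerivWithinAt f (f' x) (Set.Icc 0 1) x) ∧
  ContinuousOn f' (Set.Icc 0 1) ∧
  (∀ x ∈ Set.Icc (0:ℝ) 1, 0 < f' x)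

/-- Iterates of a strictly increasing self-map of a set are strictly increasing on it. -/
lemma StrictMonoOn.iterate_of_mapsTo {β : Type*} [Preorder β] {g : β → β} {s : Set β}
    (hmono : StrictMonoOn g s) (hmaps : MapsTo g s s) (n : ℕ) : StrictMonoOn g^[n] s := by
  induction n with
  | zero => exact strictMonoOn_id
  | succ n ih => exact ih.comp hmono hmaps

/-- The mean value theorem for a diffeomorphism of `[0,1]`. -/
lemma IsC1DiffeoWithDeriv.exists_deriv_eq_slope {f f' : ℝ → ℝ} (hf : IsC1DiffeoWithDeriv f f')
    {p q : ℝ} (hp : 0 ≤ p) (hpq : p < q) (hq : q ≤ 1) :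
    ∃ ξ ∈ Ioo p q, f q - f p = f' ξ * (q - p) := by
  have hsub : Icc p q ⊆ Icc 0 1 := Icc_subset_Icc hp hq
  obtain ⟨ξ, hξ, h⟩ := exists_hasDerivAt_eq_slope f f' hpq
    (fun x hx => ((hf.2.2.1 x (hsub hx)).continuousWithinAt).mono hsub)
    (fun x hx => (hf.2.2.1 x (hsub (Ioo_subset_Icc_self hx))).hasDerivAt
      (Icc_mem_nhds (hp.trans_lt hx.1) (hx.2.trans_le hq)))
  refine ⟨ξ, hξ, ?_⟩
  rw [h, div_mul_cancel₀ _ (sub_pos.2 hpq).ne']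

/-- A Hölder derivative bounded away from zero has Hölder logarithm. -/
lemma IsC1DiffeoWithDeriv.exists_deriv_le_exp_mul {f f' : ℝ → ℝ} (hf : IsC1DiffeoWithDeriv f f')
    {α M : ℝ} (hM : ∀ x ∈ Icc (0 : ℝ) 1, ∀ y ∈ Icc (0 : ℝ) 1, |f' x - f' y| ≤ M * |x - y| ^ α) :
    ∃ C : ℝ, 0 ≤ C ∧ ∀ x ∈ Icc (0 : ℝ) 1, ∀ y ∈ Icc (0 : ℝ) 1,
      f' x ≤ Real.exp (C * |x - y| ^ α) * f' y := by
  obtain ⟨z, hz, hmin⟩ := isCompact_Icc.exists_isMinOn (nonempty_Icc.2 zero_le_one) hf.2.2.2.1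
  have hc := hf.2.2.2.2 z hz
  refine ⟨|M| / f' z, by positivity, fun x hx y hy => ?_⟩
  have hzy : f' z ≤ f' y := hmin hy
  have hd : 0 ≤ |x - y| ^ α := by positivity
  have h1 : f' x - f' y ≤ |M| * |x - y| ^ α :=
    (le_abs_self _).trans ((hM x hx y hy).trans
      (mul_le_mul_of_nonneg_right (le_abs_self M) hd))
  have h2 : |M| * |x - y| ^ α ≤ |M| / f' z * |x - y| ^ α * f' y := by
    calc |M| * |x - y| ^ α = |M| / f' z * |x - y| ^ α * f' z := by field_simp
      _ ≤ _ := by gcongr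
  have h3 := Real.add_one_le_exp (|M| / f' z * |x - y| ^ α)
  nlinarith [mul_le_mul_of_nonneg_right h3 (hc.trans_le hzy).le]

/-- One step of the distortion estimate: a diffeomorphism changes the ratio of the lengths of two
subintervals of `[s,t]` by a factor of at most `exp (C * (t - s) ^ α)`. -/
lemma IsC1DiffeoWithDeriv.sub_mul_sub_le {f f' : ℝ → ℝ} (hf : IsC1DiffeoWithDeriv f f')
    {α C : ℝ} (hα : 0 ≤ α) (hC : 0 ≤ C)
    (h : ∀ x ∈ Icc (0 : ℝ) 1, ∀ y ∈ Icc (0 : ℝ) 1, f' x ≤ Real.exp (C * |x - y| ^ α) * f' y)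
    {s t u v p q : ℝ} (hs : 0 ≤ s) (ht : t ≤ 1) (hsu : s ≤ u) (huv : u < v) (hvt : v ≤ t)
    (hsp : s ≤ p) (hpq : p < q) (hqt : q ≤ t) :
    (f v - f u) * (q - p) ≤ Real.exp (C * (t - s) ^ α) * ((v - u) * (f q - f p)) := by
  obtain ⟨ξ, hξ, h1⟩ := hf.exists_deriv_eq_slope (hs.trans hsu) huv (hvt.trans ht)
  obtain ⟨η, hη, h2⟩ := hf.exists_deriv_eq_slope (hs.trans hsp) hpq (hqt.trans ht)
  have hξ' : ξ ∈ Icc s t := ⟨hsu.trans hξ.1.le, hξ.2.le.trans hvt⟩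
  have hη' : η ∈ Icc s t := ⟨hsp.trans hη.1.le, hη.2.le.trans hqt⟩
  have hsub : Icc s t ⊆ Icc 0 1 := Icc_subset_Icc hs ht
  have hd : |ξ - η| ≤ t - s := abs_sub_le_iff.2
    ⟨by linarith [hξ'.2, hη'.1], by linarith [hη'.2, hξ'.1]⟩
  have h3 : f' ξ ≤ Real.exp (C * (t - s) ^ α) * f' η := by
    refine (h ξ (hsub hξ') η (hsub hη')).trans ?_
    have := hf.2.2.2.2 η (hsub hη')
    gcongr
  rw [h1, h2]
  have h4 : 0 ≤ (v - u) * (q - p) := by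
    have := sub_pos.2 huv
    have := sub_pos.2 hpq
    positivity
  calc f' ξ * (v - u) * (q - p) = f' ξ * ((v - u) * (q - p)) := by ring
    _ ≤ Real.exp (C * (t - s) ^ α) * f' η * ((v - u) * (q - p)) :=
      mul_le_mul_of_nonneg_right h3 h4
    _ = _ := by ring

/-- A diffeomorphism fixing the endpoints of a short interval nearly preserves lengths there. -/
lemma IsC1DiffeoWithDeriv.exists_forall_mul_sub_le {g g' : ℝ → ℝ} (hg : IsC1DiffeoWithDeriv g g')
    {c : ℝ} (hc : c < 1) :
    ∃ ε > 0, ∀ s t : ℝ, 0 ≤ s → s < t → t ≤ 1 → g s = s → g t = t → t - s < ε →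
      ∀ p q : ℝ, s ≤ p → p < q → q ≤ t → c * (q - p) ≤ g q - g p := by
  have huc := isCompact_Icc.uniformContinuousOn_of_continuous hg.2.2.2.1
  obtain ⟨ε, hε, H⟩ := Metric.uniformContinuousOn_iff.1 huc (1 - c) (sub_pos.2 hc)
  refine ⟨ε, hε, fun s t hs hst ht hgs hgt hlt p q hp hpq hq => ?_⟩
  obtain ⟨ξ, hξ, h1⟩ := hg.exists_deriv_eq_slope hs hst ht
  obtain ⟨η, hη, h2⟩ := hg.exists_deriv_eq_slope (hs.trans hp) hpq (hq.trans ht)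
  have hξ1 : g' ξ = 1 := by
    rw [hgs, hgt] at h1
    exact mul_right_cancel₀ (sub_pos.2 hst).ne' (by linarith)
  have h3 := H ξ ⟨by linarith [hξ.1], by linarith [hξ.2]⟩ η
    ⟨by linarith [hη.1], by linarith [hη.2]⟩ (by
      rw [Real.dist_eq, abs_sub_lt_iff]
      constructor <;> linarith [hξ.1, hξ.2, hη.1, hη.2])
  rw [Real.dist_eq, abs_sub_lt_iff, hξ1] at h3
  rw [h2]
  exact mul_le_mul_of_nonneg_right (by linarith [h3.1]) (sub_pos.2 hpq).le

/-- A strictly monotone self-map of `[s,t]` that contracts differences by at most the factor `c`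
has `n`-th iterate contracting them by at most `c ^ n`. -/
lemma pow_mul_sub_le_iterate_sub {g : ℝ → ℝ} {s t c : ℝ} (hc : 0 ≤ c)
    (hmaps : MapsTo g (Icc s t) (Icc s t)) (hmono : StrictMonoOn g (Icc s t))
    (h : ∀ p q : ℝ, s ≤ p → p < q → q ≤ t → c * (q - p) ≤ g q - g p)
    {p q : ℝ} (hp : s ≤ p) (hpq : p < q) (hq : q ≤ t) (n : ℕ) :
    c ^ n * (q - p) ≤ g^[n] q - g^[n] p := by
  have hpm : p ∈ Icc s t := ⟨hp, by linarith⟩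
  have hqm : q ∈ Icc s t := ⟨by linarith, hq⟩
  induction n with
  | zero => simp
  | succ n ih =>
    have hP := hmaps.iterate n hpm
    have hQ := hmaps.iterate n hqm
    rw [Function.iterate_succ_apply', Function.iterate_succ_apply']
    have := h _ _ hP.1 (hmono.iterate_of_mapsTo hmaps n hpm hqm hpq) hQ.2
    calc c ^ (n + 1) * (q - p) = c * (c ^ n * (q - p)) := by ring
      _ ≤ c * (g^[n] q - g^[n] p) := mul_le_mul_of_nonneg_left ih hc
      _ ≤ _ := this

/-- The displacement along an orbit of a monotone self-map of a compact interval tends to zero. -/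
lemma MonotoneOn.tendsto_iterate_succ_sub {g : ℝ → ℝ} {a b x : ℝ}
    (hmono : MonotoneOn g (Icc a b)) (hmaps : MapsTo g (Icc a b) (Icc a b)) (hx : x ∈ Icc a b) :
    Filter.Tendsto (fun n => g^[n] (g x) - g^[n] x) Filter.atTop (nhds 0) := by
  have hm : ∀ n, g^[n] x ∈ Icc a b := fun n => hmaps.iterate n hx
  have hlim : ∃ l, Filter.Tendsto (fun n => g^[n] x) Filter.atTop (nhds l) := by
    rcases le_total x (g x) with h | h
    · refine ⟨_, tendsto_atTop_ciSup (monotone_nat_of_le_succ fun n => ?_)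
        ⟨b, by rintro _ ⟨n, rfl⟩; exact (hm n).2⟩⟩
      induction n with
      | zero => simpa using h
      | succ n ih =>
        rw [Function.iterate_succ_apply', Function.iterate_succ_apply' g (n + 1)]
        exact hmono (hm n) (hm (n + 1)) ih
    · refine ⟨_, tendsto_atTop_ciInf (antitone_nat_of_succ_le fun n => ?_)
        ⟨a, by rintro _ ⟨n, rfl⟩; exact (hm n).1⟩⟩
      induction n with
      | zero => simpa using h
      | succ n ih =>
        rw [Function.iterate_succ_apply' g (n + 1), Function.iterate_succ_apply' g n]
        exact hmono (hmaps (hm n)) (hm n) (Function.iterate_succ_apply' g n x ▸ ih)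
  obtain ⟨l, hl⟩ := hlim
  have := ((Filter.tendsto_add_atTop_iff_nat 1).2 hl).sub hl
  simpa only [Function.iterate_succ_apply, sub_self] using this

/-- An increasing map of `[a,b]` onto itself fixes the endpoints. -/
lemma MonotoneOn.eq_endpoints_of_image_Icc {g : ℝ → ℝ} {a b : ℝ} (hab : a ≤ b)
    (hmono : MonotoneOn g (Icc a b)) (h : g '' Icc a b = Icc a b) : g a = a ∧ g b = b := by
  have hl := left_mem_Icc.2 hab
  have hr := right_mem_Icc.2 hab
  have hga : g a ∈ Icc a b := h ▸ mem_image_of_mem g hl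
  have hgb : g b ∈ Icc a b := h ▸ mem_image_of_mem g hr
  obtain ⟨y, hy, hya⟩ := h.symm ▸ hl
  obtain ⟨z, hz, hzb⟩ := h.symm ▸ hr
  exact ⟨le_antisymm ((hmono hl hy hy.1).trans hya.le) hga.1,
    le_antisymm hgb.2 (hzb.ge.trans (hmono hz hr hz.2))⟩

/-- If `C¹` diffeomorphisms `f₁,…,f_k` of `[0,1]` commute with a `C¹` diffeomorphism `g`
which fixes a nondegenerate closed subinterval `I = [a,b]` of `[0,1]` and is not the
identity on it, and if for some sequence of indices the series
`∑_j |f_{i_j} ∘ ⋯ ∘ f_{i_1}(I)|^α` converges, then the maps `f₁,…,f_k`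
cannot all be of class `C^{1+α}`. -/
theorem no_common_holder_regularity
    (α : ℝ) (hα0 : 0 < α) (hα1 : α < 1)
    (k : ℕ) (hk : 1 ≤ k)
    (f : Fin k → ℝ → ℝ) (f' : Fin k → ℝ → ℝ) (g g' : ℝ → ℝ)
    (hf : ∀ m : Fin k, IsC1DiffeoWithDeriv (f m) (f' m))
    (hg : IsC1DiffeoWithDeriv g g')
    (hcomm : ∀ m : Fin k, ∀ x ∈ Set.Icc (0:ℝ) 1, f m (g x) = g (f m x))
    (a b : ℝ) (ha : 0 ≤ a) (hab : a < b) (hb : b ≤ 1)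
    (hgI : g '' Set.Icc a b = Set.Icc a b)
    (hgne : ∃ x ∈ Set.Icc a b, g x ≠ x)
    (i : ℕ → Fin k)
    (comp : ℕ → ℝ → ℝ)
    (hcomp0 : comp 0 = id)
    (hcompS : ∀ j : ℕ, comp (j + 1) = f (i j) ∘ comp j)
    (hsum : Summable fun j : ℕ => (comp j b - comp j a) ^ α) :
    ¬ (∀ m : Fin k, ∃ M : ℝ, ∀ x ∈ Set.Icc (0:ℝ) 1, ∀ y ∈ Set.Icc (0:ℝ) 1,
        |f' m x - f' m y| ≤ M * |x - y| ^ α) := by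
  intro hM
  choose M hM using hM
  choose C hC0 hC using fun m => (hf m).exists_deriv_le_exp_mul (hM m)
  have hCle : ∀ m, C m ≤ ∑ m, C m := fun m =>
    Finset.single_le_sum (fun m _ => hC0 m) (Finset.mem_univ m)
  set D := ∑ m, C m
  have hD0 : 0 ≤ D := Finset.sum_nonneg fun m _ => hC0 m
  have hsub : Icc a b ⊆ Icc 0 1 := Icc_subset_Icc ha hb
  have hl : a ∈ Icc a b := left_mem_Icc.2 hab.le
  have hr : b ∈ Icc a b := right_mem_Icc.2 hab.le
  have hgmaps : MapsTo g (Icc a b) (Icc a b) := mapsTo_iff_image_subset.2 hgI.le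
  have hgmono : StrictMonoOn g (Icc a b) := hg.2.1.mono hsub
  obtain ⟨hga, hgb⟩ := hgmono.monotoneOn.eq_endpoints_of_image_Icc hab.le hgI
  have hcm : ∀ n, MapsTo (comp n) (Icc 0 1) (Icc 0 1) ∧ StrictMonoOn (comp n) (Icc 0 1) ∧
      ∀ x ∈ Icc (0 : ℝ) 1, comp n (g x) = g (comp n x) := by
    intro n
    induction n with
    | zero => rw [hcomp0]; exact ⟨mapsTo_id _, strictMonoOn_id, fun _ _ => rfl⟩
    | succ n ih =>
      obtain ⟨h1, h2, h3⟩ := ih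
      rw [hcompS]
      refine ⟨(hf (i n)).1.mapsTo.comp h1, (hf (i n)).2.1.comp h2 h1, fun x hx => ?_⟩
      simp only [Function.comp_apply, h3 x hx, hcomm _ _ (h1 hx)]
  have hlen : ∀ n, comp n a < comp n b := fun n => (hcm n).2.1 (hsub hl) (hsub hr) hab
  have hmem : ∀ n, ∀ x ∈ Icc a b, comp n x ∈ Icc (comp n a) (comp n b) := fun n x hx =>
    ⟨(hcm n).2.1.monotoneOn (hsub hl) (hsub hx) hx.1,
      (hcm n).2.1.monotoneOn (hsub hx) (hsub hr) hx.2⟩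
  have hdist : ∀ u ∈ Icc a b, ∀ v ∈ Icc a b, u < v → ∀ p ∈ Icc a b, ∀ q ∈ Icc a b, p < q →
      ∀ n, (comp n v - comp n u) * (q - p) ≤
        Real.exp (∑ j ∈ Finset.range n, D * (comp j b - comp j a) ^ α) *
          ((v - u) * (comp n q - comp n p)) := by
    intro u hu v hv huv p hp q hq hpq n
    induction n with
    | zero => simp [hcomp0]
    | succ n ih =>
      have h1 := (hcm n).1 (hsub hl)
      have h2 := (hcm n).1 (hsub hr)
      have hposu := sub_pos.2 ((hcm n).2.1 (hsub hu) (hsub hv) huv)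
      have hposp := sub_pos.2 ((hcm n).2.1 (hsub hp) (hsub hq) hpq)
      have hstep := (hf (i n)).sub_mul_sub_le hα0.le (hD0) (fun x hx y hy =>
        (hC (i n) x hx y hy).trans (by
          have := (hf (i n)).2.2.2.2 y hy
          have := hCle (i n)
          gcongr)) h1.1 h2.2
        (hmem n u hu).1 (sub_pos.1 hposu) (hmem n v hv).2
        (hmem n p hp).1 (sub_pos.1 hposp) (hmem n q hq).2
      rw [hcompS, Finset.sum_range_succ, Real.exp_add]
      simp only [Function.comp_apply]
      set E := Real.exp (∑ j ∈ Finset.range n, D * (comp j b - comp j a) ^ α)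
      set e := Real.exp (D * (comp n b - comp n a) ^ α)
      set U := comp n v - comp n u
      set P := comp n q - comp n p
      set U' := f (i n) (comp n v) - f (i n) (comp n u)
      have hP' : 0 < f (i n) (comp n q) - f (i n) (comp n p) :=
        sub_pos.2 ((hf (i n)).2.1 ((hcm n).1 (hsub hp)) ((hcm n).1 (hsub hq)) (sub_pos.1 hposp))
      set P' := f (i n) (comp n q) - f (i n) (comp n p)
      have hqp := sub_pos.2 hpq
      have he : 0 < e := Real.exp_pos _
      refine le_of_mul_le_mul_right ?_ hposp
      calc U' * (q - p) * P = (U' * P) * (q - p) := by ring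
        _ ≤ (e * (U * P')) * (q - p) := mul_le_mul_of_nonneg_right hstep hqp.le
        _ = (e * P') * (U * (q - p)) := by ring
        _ ≤ (e * P') * (E * ((v - u) * P)) := mul_le_mul_of_nonneg_left ih (by positivity)
        _ = _ := by ring
  set K := Real.exp (D * ∑' j, (comp j b - comp j a) ^ α)
  have hKpos : 0 < K := Real.exp_pos _
  have hK : ∀ n, Real.exp (∑ j ∈ Finset.range n, D * (comp j b - comp j a) ^ α) ≤ K := by
    intro n
    refine Real.exp_le_exp.2 ?_
    rw [← Finset.mul_sum]
    exact mul_le_mul_of_nonneg_left (hsum.sum_le_tsum _ fun j _ =>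
      Real.rpow_nonneg (sub_pos.2 (hlen j)).le α) hD0
  have hiter : ∀ n N, ∀ x ∈ Icc a b, comp n (g^[N] x) = g^[N] (comp n x) := by
    intro n N x hx
    induction N with
    | zero => rfl
    | succ N ih =>
      rw [Function.iterate_succ_apply', Function.iterate_succ_apply',
        (hcm n).2.2 _ (hsub (hgmaps.iterate N hx)), ih]
  have hshort : ∀ ε > 0, ∃ n, comp n b - comp n a < ε := by
    intro ε hε
    obtain ⟨n, hn⟩ := (hsum.tendsto_atTop_zero.eventually
      (gt_mem_nhds (Real.rpow_pos_of_pos hε α))).exists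
    exact ⟨n, (Real.rpow_lt_rpow_iff (sub_pos.2 (hlen n)).le hε.le hα0).1 hn⟩
  have hbound : ∀ u ∈ Icc a b, ∀ v ∈ Icc a b, u < v → ∀ N,
      v - u ≤ K * (g^[N] v - g^[N] u) := by
    intro u hu v hv huv N
    have hU := hgmaps.iterate N hu
    have hV := hgmaps.iterate N hv
    have hUV := hgmono.iterate_of_mapsTo hgmaps N hu hv huv
    have key : ∀ c : ℝ, 0 < c → c < 1 → c ^ N * (v - u) ≤ K * (g^[N] v - g^[N] u) := by
      intro c hc0 hc1
      obtain ⟨ε, hε, H⟩ := hg.exists_forall_mul_sub_le hc1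
      obtain ⟨n, hn⟩ := hshort ε hε
      have h1 := (hcm n).1 (hsub hl)
      have h2 := (hcm n).1 (hsub hr)
      have hfa : g (comp n a) = comp n a := by rw [← (hcm n).2.2 a (hsub hl), hga]
      have hfb : g (comp n b) = comp n b := by rw [← (hcm n).2.2 b (hsub hr), hgb]
      have hIsub : Icc (comp n a) (comp n b) ⊆ Icc 0 1 := Icc_subset_Icc h1.1 h2.2
      have hmono' : StrictMonoOn g (Icc (comp n a) (comp n b)) := hg.2.1.mono hIsub
      have hmaps' : MapsTo g (Icc (comp n a) (comp n b)) (Icc (comp n a) (comp n b)) := by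
        have := hmono'.monotoneOn.mapsTo_Icc
        rwa [hfa, hfb] at this
      have huv' := (hcm n).2.1 (hsub hu) (hsub hv) huv
      have hc := pow_mul_sub_le_iterate_sub hc0.le hmaps' hmono'
        (H _ _ h1.1 (hlen n) h2.2 hfa hfb hn) (hmem n u hu).1 huv' (hmem n v hv).2 N
      rw [← hiter n N u hu, ← hiter n N v hv] at hc
      have hd := hdist _ hU _ hV hUV u hu v hv huv n
      have hL := sub_pos.2 huv'
      have hT := sub_pos.2 hUV
      have huv0 := sub_pos.2 huv
      refine le_of_mul_le_mul_right ?_ hL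
      calc c ^ N * (v - u) * (comp n v - comp n u)
          = c ^ N * (comp n v - comp n u) * (v - u) := by ring
        _ ≤ (comp n (g^[N] v) - comp n (g^[N] u)) * (v - u) :=
          mul_le_mul_of_nonneg_right hc huv0.le
        _ ≤ _ := hd
        _ ≤ K * ((g^[N] v - g^[N] u) * (comp n v - comp n u)) :=
          mul_le_mul_of_nonneg_right (hK n) (by positivity)
        _ = _ := by ring
    have hcont : Filter.Tendsto (fun c : ℝ => c ^ N * (v - u)) (nhdsWithin 1 (Iio 1))
        (nhds (v - u)) := by
      have : Continuous fun c : ℝ => c ^ N * (v - u) := by fun_prop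
      simpa using (this.tendsto 1).mono_left (nhdsWithin_le_nhds (s := Iio 1))
    refine le_of_tendsto hcont ?_
    filter_upwards [Ioo_mem_nhdsLT (zero_lt_one' ℝ)] with c hc using key c hc.1 hc.2
  obtain ⟨x, hx, hne⟩ := hgne
  have habs : ∀ N, |g x - x| ≤ K * |g^[N] (g x) - g^[N] x| := by
    intro N
    rcases hne.lt_or_gt with h | h
    · rw [abs_sub_comm, abs_sub_comm (g^[N] (g x)), abs_of_pos (sub_pos.2 h)]
      exact (hbound _ (hgmaps hx) _ hx h N).trans
        (mul_le_mul_of_nonneg_left (le_abs_self _) hKpos.le)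
    · rw [abs_of_pos (sub_pos.2 h)]
      exact (hbound _ hx _ (hgmaps hx) h N).trans
        (mul_le_mul_of_nonneg_left (le_abs_self _) hKpos.le)
  have hlim := ((hgmono.monotoneOn.tendsto_iterate_succ_sub hgmaps hx).abs).const_mul K
  rw [abs_zero, mul_zero] at hlim
  exact absurd (ge_of_tendsto' hlim habs) (not_le.2 (abs_pos.2 (sub_ne_zero.2 hne)))
end

section
/- Let M > N be positive integers, with N of the form N = 1 + 2^k for some integer k ≥ 1. Then there exists a partition of ℕ₀ = {0,1,2,…} into N infinite subsets (called paths) such that: (i) for each path, any two consecutive elements of the path (in increasing order) differ by either M or 1; and (ii) for all integers 0 ≤ K₁ < K₂, the maximal number of elements of a path contained in {K₁, K₁+1, …, K₂} and the minimal such number (over the N paths) differ by at most 4 + 2(M−1)/(N−1) + 4·log₂(N−1). -/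
open Set

/-- The left endpoint of the `j`-th block when `ℕ` is cut into consecutive blocks of average
length `m / p`. -/
def blockStart (m p j : ℕ) : ℕ := j * m / p

/-- The index of the block containing `x`. -/
def blockIndex (m p x : ℕ) : ℕ := (p * x + (p - 1)) / m

/-- The path traversing the blocks with index congruent to `i` modulo `p + 1`. -/
def blockPath (m p i r : ℕ) : ℕ :=
  blockStart m p i + r + (blockIndex m p (blockStart m p i + r) - i) * m

section Blocks

variable {m p : ℕ}

lemma le_blockIndex_iff (hp : 0 < p) (hpm : p ≤ m) (j x : ℕ) :
    j ≤ blockIndex m p x ↔ blockStart m p j ≤ x := by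
  unfold blockIndex blockStart
  rw [Nat.le_div_iff_mul_le (hp.trans_le hpm), ← Nat.lt_succ_iff,
    ← Nat.lt_succ_iff (m := j * m / p), Nat.div_lt_iff_lt_mul hp, Nat.succ_mul x p, mul_comm x p]
  omega

lemma blockIndex_mono : Monotone (blockIndex m p) := fun x y h => by
  unfold blockIndex
  gcongr

lemma blockIndex_add_mul (hp : 0 < p) (hpm : p ≤ m) (x t : ℕ) :
    blockIndex m p (x + t * m) = blockIndex m p x + t * p := by
  unfold blockIndex
  rw [← Nat.add_mul_div_right _ _ (hp.trans_le hpm)]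
  congr 1
  ring

lemma blockIndex_succ (hp : 0 < p) (hpm : p ≤ m) (x : ℕ) :
    blockIndex m p (x + 1) = blockIndex m p x ∨
      blockIndex m p (x + 1) = blockIndex m p x + 1 := by
  have h₁ : blockIndex m p x ≤ blockIndex m p (x + 1) := blockIndex_mono (Nat.le_succ x)
  have h₂ : blockIndex m p (x + 1) ≤ blockIndex m p x + 1 := by
    unfold blockIndex
    rw [← Nat.add_div_right _ (hp.trans_le hpm)]
    apply Nat.div_le_div_right
    rw [mul_add]
    omega
  omega

lemma le_blockIndex_start_add (hp : 0 < p) (hpm : p ≤ m) (i r : ℕ) :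
    i ≤ blockIndex m p (blockStart m p i + r) :=
  (le_blockIndex_iff hp hpm _ _).2 (Nat.le_add_right _ _)

lemma blockPath_succ (hp : 0 < p) (hpm : p ≤ m) (i r : ℕ) :
    blockPath m p i (r + 1) = blockPath m p i r + (m + 1) ∨
      blockPath m p i (r + 1) = blockPath m p i r + 1 := by
  have h := le_blockIndex_start_add hp hpm i r
  unfold blockPath
  rw [← add_assoc]
  rcases blockIndex_succ hp hpm (blockStart m p i + r) with h' | h' <;> rw [h']
  · right
    ring
  · left
    rw [Nat.sub_add_comm h]
    ring

lemma blockPath_strictMono (hp : 0 < p) (hpm : p ≤ m) (i : ℕ) :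
    StrictMono (blockPath m p i) :=
  strictMono_nat_of_lt_succ fun r => by
    rcases blockPath_succ hp hpm i r with h | h <;> omega

lemma blockIndex_blockPath (hp : 0 < p) (hpm : p ≤ m) (i r : ℕ) :
    blockIndex m p (blockPath m p i r) =
      i + (blockIndex m p (blockStart m p i + r) - i) * (p + 1) := by
  have h := le_blockIndex_start_add hp hpm i r
  rw [blockPath, blockIndex_add_mul hp hpm, mul_add]
  omega

lemma exists_blockPath_eq (hp : 0 < p) (hpm : p ≤ m) (n : ℕ) :
    ∃ r, blockPath m p (blockIndex m p n % (p + 1)) r = n := by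
  set i := blockIndex m p n % (p + 1) with hi
  set t := blockIndex m p n / (p + 1) with ht
  have hn : blockIndex m p n = i + t * (p + 1) := by
    rw [hi, ht, mul_comm, Nat.mod_add_div]
  clear_value i t
  have htm : t * m ≤ n := by
    have h : t * p ≤ blockIndex m p n := by rw [hn, mul_add]; omega
    rw [le_blockIndex_iff hp hpm, blockStart, mul_right_comm, Nat.mul_div_cancel _ hp] at h
    exact h
  obtain ⟨x, rfl⟩ := Nat.exists_eq_add_of_le' htm
  have hx : blockIndex m p x = i + t := by
    rw [blockIndex_add_mul hp hpm, mul_add] at hn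
    omega
  have hix : blockStart m p i ≤ x := (le_blockIndex_iff hp hpm _ _).1 (by omega)
  obtain ⟨r, rfl⟩ := Nat.exists_eq_add_of_le hix
  exact ⟨r, by rw [blockPath, hx, Nat.add_sub_cancel_left]⟩

lemma lt_of_blockPath_lt (hp : 0 < p) (hpm : p ≤ m) {i r K : ℕ}
    (h : blockPath m p i r < K) :
    blockStart m p i + r < blockStart m p (i + blockIndex m p K / (p + 1) + 1) := by
  have hle := blockIndex_mono (m := m) (p := p) h.le
  rw [blockIndex_blockPath hp hpm] at hle
  have ht : blockIndex m p (blockStart m p i + r) - i ≤ blockIndex m p K / (p + 1) :=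
    (Nat.le_div_iff_mul_le p.succ_pos).2 (by rw [Nat.succ_eq_add_one]; omega)
  rw [← not_le, ← le_blockIndex_iff hp hpm]
  omega

lemma blockPath_lt (hp : 0 < p) (hpm : p ≤ m) {i r K : ℕ} (hi : i < p + 1)
    (h : blockStart m p i + r < blockStart m p (i + blockIndex m p K / (p + 1))) :
    blockPath m p i r < K := by
  rw [← not_le, ← le_blockIndex_iff hp hpm] at h
  have hir := le_blockIndex_start_add hp hpm i r
  refine blockIndex_mono.reflect_lt (f := blockIndex m p) ?_
  rw [blockIndex_blockPath hp hpm]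
  have ht : blockIndex m p (blockStart m p i + r) - i + 1 ≤ blockIndex m p K / (p + 1) := by
    omega
  have := (Nat.le_div_iff_mul_le p.succ_pos).1 ht
  rw [Nat.succ_eq_add_one, add_mul] at this
  omega

lemma blockStart_le (j : ℕ) : (blockStart m p j : ℝ) ≤ j * (m / p : ℝ) := by
  have := Nat.cast_div_le (α := ℝ) (m := j * m) (n := p)
  rw [Nat.cast_mul, mul_div_assoc] at this
  exact this

lemma lt_blockStart_add_one (hp : 0 < p) (j : ℕ) :
    j * (m / p : ℝ) < blockStart m p j + 1 := by
  have hp' : (0 : ℝ) < p := by exact_mod_cast hp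
  rw [← mul_div_assoc, div_lt_iff₀ hp']
  have h : j * m < (blockStart m p j + 1) * p := by
    rw [mul_comm _ p]
    exact Nat.lt_mul_div_succ _ hp
  exact_mod_cast h

end Blocks

lemma StrictMono.exists_lt_iff_lt {u : ℕ → ℕ} (hu : StrictMono u) (K : ℕ) :
    ∃ c, ∀ r, u r < K ↔ r < c := by
  classical
  have h : ∃ r, K ≤ u r := ⟨K, hu.le_apply⟩
  refine ⟨Nat.find h, fun r => ⟨fun hr => ?_, fun hr => not_le.1 (Nat.find_min h hr)⟩⟩
  exact hu.lt_iff_lt.1 (hr.trans_le (Nat.find_spec h))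

lemma StrictMono.ncard_range_inter_Icc {u : ℕ → ℕ} (hu : StrictMono u) {K₁ K₂ c₁ c₂ : ℕ}
    (h₁ : ∀ r, u r < K₁ ↔ r < c₁) (h₂ : ∀ r, u r < K₂ + 1 ↔ r < c₂) :
    (Set.range u ∩ Set.Icc K₁ K₂).ncard = c₂ - c₁ := by
  have : Set.range u ∩ Set.Icc K₁ K₂ = u '' (Finset.Ico c₁ c₂ : Finset ℕ) := by
    ext n
    simp only [Set.mem_inter_iff, Set.mem_range, Set.mem_Icc, Set.mem_image, Finset.coe_Ico,
      Set.mem_Ico]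
    constructor
    · rintro ⟨⟨r, rfl⟩, ha, hb⟩
      exact ⟨r, ⟨not_lt.1 (mt (h₁ r).2 ha.not_gt), (h₂ r).1 (Nat.lt_succ_of_le hb)⟩, rfl⟩
    · rintro ⟨r, ⟨ha, hb⟩, rfl⟩
      exact ⟨⟨r, rfl⟩, not_lt.1 (mt (h₁ r).1 ha.not_gt), Nat.le_of_lt_succ ((h₂ r).2 hb)⟩
  rw [this, Set.ncard_image_of_injective _ hu.injective, Set.ncard_coe_finset, Nat.card_Ico]

/-- The number of elements of a path below `K` is determined up to `m / p + 2`,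
independently of the path. -/
lemma blockPath_count_bounds {m p : ℕ} (hp : 0 < p) (hpm : p ≤ m) {i K c : ℕ}
    (hi : i < p + 1) (hc : ∀ r, blockPath m p i r < K ↔ r < c) :
    ((blockIndex m p K / (p + 1) : ℕ) : ℝ) * (m / p) - 1 ≤ c ∧
      (c : ℝ) ≤ ((blockIndex m p K / (p + 1) : ℕ) : ℝ) * (m / p) + m / p + 1 := by
  set q := blockIndex m p K / (p + 1) with hq
  have hlo : blockStart m p (i + q) ≤ blockStart m p i + c := by
    by_contra! h
    exact lt_irrefl c ((hc c).1 (blockPath_lt hp hpm hi h))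
  have hup : blockStart m p i + c ≤ blockStart m p (i + q + 1) := by
    rcases c with _ | c
    · exact Nat.div_le_div_right (Nat.mul_le_mul_right _ (by rw [add_assoc]; exact Nat.le_add_right _ _))
    · exact lt_of_blockPath_lt hp hpm ((hc c).2 (Nat.lt_succ_self c))
  have hlo' : (blockStart m p (i + q) : ℝ) ≤ blockStart m p i + c := by exact_mod_cast hlo
  have hup' : (blockStart m p i : ℝ) + c ≤ blockStart m p (i + q + 1) := by exact_mod_cast hup
  have h₁ := blockStart_le (m := m) (p := p) i
  have h₂ := lt_blockStart_add_one (m := m) hp i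
  have h₃ := lt_blockStart_add_one (m := m) hp (i + q)
  have h₄ := blockStart_le (m := m) (p := p) (i + q + 1)
  push_cast at h₃ h₄
  constructor <;> linarith

/-- **Combinatorial lemma.** Let `M > N` be positive integers with `N = 1 + 2^k`,
`k ≥ 1`. Then `ℕ₀` can be partitioned into `N` infinite subsets (paths), here
given by their strictly increasing enumerations `u i`, such that:
(i) consecutive elements of each path differ by either `M` or `1`; and
(ii) for all `0 ≤ K₁ < K₂`, the numbers of elements of any two paths inside
`[[K₁, K₂]]` differ by at most `4 + 2(M-1)/(N-1) + 4 log₂(N-1)`. -/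
theorem partition_into_paths (k M N : ℕ) (hk : 1 ≤ k) (hN : N = 1 + 2 ^ k)
    (hMN : N < M) :
    ∃ u : Fin N → ℕ → ℕ,
      (∀ i, StrictMono (u i)) ∧
      (∀ i, (Set.range (u i)).Infinite) ∧
      (∀ i j, i ≠ j → Disjoint (Set.range (u i)) (Set.range (u j))) ∧
      (⋃ i, Set.range (u i)) = Set.univ ∧
      (∀ i t, u i (t + 1) = u i t + M ∨ u i (t + 1) = u i t + 1) ∧
      (∀ K₁ K₂ : ℕ, K₁ < K₂ → ∀ i j : Fin N,
        ((Set.range (u i) ∩ Set.Icc K₁ K₂).ncard : ℝ) ≤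
          ((Set.range (u j) ∩ Set.Icc K₁ K₂).ncard : ℝ) +
            (4 + 2 * ((M : ℝ) - 1) / ((N : ℝ) - 1) +
              4 * Real.logb 2 ((N : ℝ) - 1))) := by
  obtain ⟨m, rfl⟩ : ∃ m, M = m + 1 := ⟨M - 1, by omega⟩
  obtain ⟨p, hpk⟩ : ∃ p, p = 2 ^ k := ⟨_, rfl⟩
  rw [← hpk, add_comm] at hN
  subst hN
  have hp : 0 < p := hpk ▸ Nat.two_pow_pos k
  have hpm : p ≤ m := by omega
  have hmono := fun i : Fin (p + 1) => blockPath_strictMono hp hpm i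
  refine ⟨fun i => blockPath m p i, hmono,
    fun i => Set.infinite_range_of_injective (hmono i).injective, ?_, ?_,
    fun i t => blockPath_succ hp hpm i t, ?_⟩
  · intro i j hij
    rw [Set.disjoint_left]
    rintro _ ⟨r, rfl⟩ ⟨s, hs⟩
    have h := congrArg (fun n => blockIndex m p n % (p + 1)) hs
    simp only [blockIndex_blockPath hp hpm, Nat.add_mul_mod_self_right, Nat.mod_eq_of_lt i.isLt,
      Nat.mod_eq_of_lt j.isLt] at h
    exact hij (Fin.ext h.symm)
  · refine Set.eq_univ_of_forall fun n => Set.mem_iUnion.2 ?_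
    exact ⟨⟨blockIndex m p n % (p + 1), Nat.mod_lt _ p.succ_pos⟩, exists_blockPath_eq hp hpm n⟩
  · intro K₁ K₂ hK i j
    have hlog : 0 ≤ Real.logb 2 (((p + 1 : ℕ) : ℝ) - 1) := by
      apply Real.logb_nonneg one_lt_two
      push_cast
      rw [add_sub_cancel_right]
      exact_mod_cast hp
    obtain ⟨a₁, ha₁⟩ := (hmono i).exists_lt_iff_lt K₁
    obtain ⟨a₂, ha₂⟩ := (hmono i).exists_lt_iff_lt (K₂ + 1)
    obtain ⟨b₁, hb₁⟩ := (hmono j).exists_lt_iff_lt K₁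
    obtain ⟨b₂, hb₂⟩ := (hmono j).exists_lt_iff_lt (K₂ + 1)
    have ha : a₁ ≤ a₂ := by
      by_contra! h
      exact lt_irrefl a₂ ((ha₂ a₂).1 (((ha₁ a₂).2 h).trans (by omega)))
    rw [(hmono i).ncard_range_inter_Icc ha₁ ha₂, (hmono j).ncard_range_inter_Icc hb₁ hb₂,
      Nat.cast_sub ha]
    have hb : (b₂ : ℝ) - b₁ ≤ (b₂ - b₁ : ℕ) := by
      rw [sub_le_iff_le_add]
      exact_mod_cast le_tsub_add
    have h₁ := blockPath_count_bounds hp hpm i.isLt ha₁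
    have h₂ := blockPath_count_bounds hp hpm i.isLt ha₂
    have h₃ := blockPath_count_bounds hp hpm j.isLt hb₁
    have h₄ := blockPath_count_bounds hp hpm j.isLt hb₂
    have hdiv : 2 * (((m + 1 : ℕ) : ℝ) - 1) / (((p + 1 : ℕ) : ℝ) - 1) = 2 * (m / p : ℝ) := by
      push_cast
      rw [add_sub_cancel_right, add_sub_cancel_right, mul_div_assoc]
    rw [hdiv]
    linarith [h₁.1, h₂.2, h₃.2, h₄.1]
end

section
/- Let k ≥ 1 be an integer and let q be an integer with 0 ≤ q < 2^k, with binary expansion q = 2^{r_1} + ⋯ + 2^{r_l} where r_1 > r_2 > ⋯ > r_l ≥ 0 (l = 0 when q = 0). For each integer i ≥ 1 define s_i as the largest index s ∈ {1,…,l} such that 2^{k−r_s} divides i, and s_i := 0 if no such index exists. Then ∑_{i=1}^{2^k} s_i = q. -/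
open Finset

/-- If divisibility by `d t` gets stronger as `t` grows, then the divisors `d t` of `i` are those
with `t ≤ s`, where `s` is the largest index with `d s ∣ i`. -/
theorem card_filter_dvd_of_isGreatest {l : ℕ} (d : Fin l → ℕ)
    (hd : ∀ t s : Fin l, t ≤ s → d t ∣ d s) {i : ℕ} {s : Fin l} (hs : d s ∣ i)
    (hmax : ∀ t : Fin l, d t ∣ i → t ≤ s) :
    #{t : Fin l | d t ∣ i} = (s : ℕ) + 1 := by
  have h : ({t : Fin l | d t ∣ i} : Finset (Fin l)) = Finset.Iic s := by
    ext t
    simp only [mem_filter_univ, mem_Iic]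
    exact ⟨hmax t, fun hts => (hd t s hts).trans hs⟩
  rw [h, Fin.card_Iic]

theorem card_Icc_filter_two_pow_sub_dvd {k r : ℕ} (hr : r ≤ k) :
    #{i ∈ Finset.Icc 1 (2 ^ k) | 2 ^ (k - r) ∣ i} = 2 ^ r := by
  have h : Finset.Icc 1 (2 ^ k) = Finset.Ioc 0 (2 ^ k) := rfl
  rw [h, Nat.Ioc_filter_dvd_card_eq_div, Nat.pow_div (Nat.sub_le k r) two_pos,
    Nat.sub_sub_self hr]

/-- Let `q < 2^k` have binary expansion `q = 2^{r 0} + ⋯ + 2^{r (l-1)}` with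
strictly decreasing exponents. For `i ≥ 1` let `S i` be the largest (1-based)
index `s` such that `2^(k - r_s)` divides `i`, and `0` if there is none.
Then `∑_{i=1}^{2^k} S i = q`. -/
theorem sum_of_largest_dividing_index (k : ℕ) (hk : 1 ≤ k)
    (q : ℕ) (hq : q < 2 ^ k)
    (l : ℕ) (r : Fin l → ℕ) (hr : StrictAnti r)
    (hexp : q = ∑ s : Fin l, 2 ^ (r s))
    (S : ℕ → ℕ)
    (hS : ∀ i : ℕ, 1 ≤ i →
      ((∀ s : Fin l, ¬ (2 ^ (k - r s) ∣ i)) ∧ S i = 0) ∨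
      (∃ s : Fin l, (2 ^ (k - r s) ∣ i) ∧
        (∀ t : Fin l, (2 ^ (k - r t) ∣ i) → t ≤ s) ∧ S i = (s : ℕ) + 1)) :
    ∑ i ∈ Finset.Icc 1 (2 ^ k), S i = q := by
  have hlt (s : Fin l) : r s ≤ k := by
    refine (Nat.pow_le_pow_iff_right one_lt_two).1 (le_trans ?_ hq.le)
    rw [hexp]
    exact Finset.single_le_sum (f := fun s => 2 ^ r s) (fun _ _ => Nat.zero_le _)
      (Finset.mem_univ s)
  have hcard : ∀ i ∈ Finset.Icc 1 (2 ^ k), S i = #{t : Fin l | 2 ^ (k - r t) ∣ i} := by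
    intro i hi
    rcases hS i (Finset.mem_Icc.1 hi).1 with ⟨hnone, h0⟩ | ⟨s, hs, hmax, hSi⟩
    · simp [h0, hnone]
    · rw [hSi, card_filter_dvd_of_isGreatest (fun t => 2 ^ (k - r t)) _ hs hmax]
      exact fun t s hts => pow_dvd_pow 2 (Nat.sub_le_sub_left (hr.antitone hts) k)
  rw [Finset.sum_congr rfl hcard, hexp]
  simp only [Finset.card_filter]
  rw [Finset.sum_comm]
  refine Finset.sum_congr rfl fun s _ => ?_
  rw [← Finset.card_filter, card_Icc_filter_two_pow_sub_dvd (hlt s)]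
end

section
/- Let k ≥ 1 be an integer and let q be an integer with 0 ≤ q < 2^k, with binary expansion q = 2^{r_1} + ⋯ + 2^{r_l} where r_1 > r_2 > ⋯ > r_l ≥ 0. For each integer i ≥ 1 define s_i as the largest index s ∈ {1,…,l} such that 2^{k−r_s} divides i, and s_i := 0 if no such index exists. Then for all integers i ≥ 1, j ≥ 1 and t ≥ 0, the sums of s over any two windows of t+1 consecutive indices differ by at most l: |∑_{a=0}^{t} s_{i+a} − ∑_{a=0}^{t} s_{j+a}| ≤ l ≤ k. -/
open Finset

/-- Among `n` consecutive positive integers, the number of multiples of `d` is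
`n / d` or `n / d + 1`. -/
theorem sum_ite_dvd_window {d : ℕ} (hd : 0 < d) (m n : ℕ) :
    ∑ a ∈ range n, (if d ∣ m + 1 + a then 1 else 0) =
      n / d + if d ≤ m % d + n % d then 1 else 0 := by
  have h : m / d + ∑ a ∈ range n, (if d ∣ m + 1 + a then 1 else 0) = (m + n) / d := by
    induction n with
    | zero => simp
    | succ n ih =>
      rw [sum_range_succ, ← add_assoc, ih, ← add_assoc m n 1, Nat.succ_div,
        add_right_comm m 1 n]
  rw [Nat.add_div hd] at h
  omega

/-- Two windows of the same length contain numbers of multiples of `d` differing by at most one. -/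
theorem abs_sum_ite_dvd_window_sub_le {d : ℕ} (hd : 0 < d) {i j : ℕ} (hi : 1 ≤ i) (hj : 1 ≤ j)
    (n : ℕ) :
    |∑ a ∈ range n, (if d ∣ i + a then (1 : ℤ) else 0) -
      ∑ a ∈ range n, (if d ∣ j + a then (1 : ℤ) else 0)| ≤ 1 := by
  obtain ⟨i, rfl⟩ := Nat.exists_eq_add_of_le' hi
  obtain ⟨j, rfl⟩ := Nat.exists_eq_add_of_le' hj
  have h₁ := congrArg (Nat.cast : ℕ → ℤ) (sum_ite_dvd_window hd i n)
  have h₂ := congrArg (Nat.cast : ℕ → ℤ) (sum_ite_dvd_window hd j n)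
  push_cast at h₁ h₂
  rw [h₁, h₂, abs_le]
  constructor <;> split_ifs <;> omega

/-- Let `q < 2^k` have binary expansion `q = 2^{r 0} + ⋯ + 2^{r (l-1)}` with
strictly decreasing exponents. For `i ≥ 1` let `S i` be the largest (1-based)
index `s` such that `2^(k - r_s)` divides `i`, and `0` if there is none.
Then `l ≤ k` and the sums of `S` over any two windows of `t+1` consecutive
indices differ by at most `l`. -/
theorem window_sums_of_largest_dividing_index (k : ℕ) (hk : 1 ≤ k)
    (q : ℕ) (hq : q < 2 ^ k)
    (l : ℕ) (r : Fin l → ℕ) (hr : StrictAnti r)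
    (hexp : q = ∑ s : Fin l, 2 ^ (r s))
    (S : ℕ → ℕ)
    (hS : ∀ i : ℕ, 1 ≤ i →
      ((∀ s : Fin l, ¬ (2 ^ (k - r s) ∣ i)) ∧ S i = 0) ∨
      (∃ s : Fin l, (2 ^ (k - r s) ∣ i) ∧
        (∀ t : Fin l, (2 ^ (k - r t) ∣ i) → t ≤ s) ∧ S i = (s : ℕ) + 1)) :
    l ≤ k ∧
    ∀ i j t : ℕ, 1 ≤ i → 1 ≤ j →
      |(∑ a ∈ Finset.range (t + 1), (S (i + a) : ℤ)) -
        ∑ a ∈ Finset.range (t + 1), (S (j + a) : ℤ)| ≤ (l : ℤ) := by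
  constructor
  · have hlt (s : Fin l) : r s < k := by
      refine (Nat.pow_lt_pow_iff_right one_lt_two).1 (lt_of_le_of_lt ?_ hq)
      rw [hexp]
      exact single_le_sum (f := fun s => 2 ^ r s) (fun _ _ => Nat.zero_le _) (mem_univ s)
    simpa using Fintype.card_le_of_injective (fun s => (⟨r s, hlt s⟩ : Fin k))
      fun a b h => hr.injective (congrArg Fin.val h)
  · intro i j t hi hj
    have hcount (n : ℕ) (hn : 1 ≤ n) :
        (S n : ℤ) = ∑ s : Fin l, if 2 ^ (k - r s) ∣ n then (1 : ℤ) else 0 := by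
      rw [sum_boole]
      rcases hS n hn with ⟨h, h0⟩ | ⟨s, hs, hmax, h1⟩
      · simp [h, h0]
      · have hfilter : ({x | 2 ^ (k - r x) ∣ n} : Finset (Fin l)) = Iic s := by
          ext x
          simp only [mem_filter, mem_univ, true_and, mem_Iic]
          refine ⟨hmax x, fun hx => (pow_dvd_pow 2 ?_).trans hs⟩
          exact Nat.sub_le_sub_left (hr.antitone hx) k
        rw [hfilter, Fin.card_Iic, h1]
    have hwindow (n : ℕ) (hn : 1 ≤ n) :
        ∑ a ∈ range (t + 1), (S (n + a) : ℤ) =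
          ∑ s : Fin l, ∑ a ∈ range (t + 1), if 2 ^ (k - r s) ∣ n + a then (1 : ℤ) else 0 := by
      rw [sum_comm]
      exact sum_congr rfl fun a _ => hcount _ (hn.trans (Nat.le_add_right n a))
    rw [hwindow i hi, hwindow j hj, ← sum_sub_distrib]
    calc _ ≤ ∑ s : Fin l, (1 : ℤ) := (abs_sum_le_sum_abs _ _).trans <| sum_le_sum fun s _ =>
            abs_sum_ite_dvd_window_sub_le (by positivity) hi hj (t + 1)
      _ = l := by simp
end

section
/- Let n ≥ 2 and m be integers with n ≤ m ≤ 2n − 1. Then there exists a partition of ℕ₀ = {0,1,2,…} into n infinite subsets (paths) such that: each path, listed in increasing order, has successive differences which repeat periodically (possibly after a shift of the pattern) the pattern consisting of n − 1 jumps of size m followed by m − n jumps of size 1; and for every integer K ≥ 1, the number of elements of each path contained in {0, 1, …, K − 1} lies between K/n − 2n and K/n + 2n. -/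
open Set

/-- The number of long jumps among the first `T` jumps of the `p`-periodic pattern consisting of
`k` long jumps followed by `p - k` short ones. -/
def longJumps (k p T : ℕ) : ℕ := k * (T / p) + min (T % p) k

lemma longJumps_mul_add {k p r : ℕ} (q : ℕ) (hr : r < p) :
    longJumps k p (p * q + r) = k * q + min r k := by
  have hp : 0 < p := by omega
  rw [longJumps, Nat.mul_add_div hp, Nat.mul_add_mod, Nat.div_eq_of_lt hr, Nat.mod_eq_of_lt hr,
    Nat.add_zero]

lemma exists_eq_mul_add {p : ℕ} (hp : 0 < p) (T : ℕ) : ∃ q r, r < p ∧ T = p * q + r :=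
  ⟨T / p, T % p, Nat.mod_lt T hp, (Nat.div_add_mod T p).symm⟩

lemma longJumps_succ {k p : ℕ} (hp : 0 < p) (hkp : k ≤ p) (T : ℕ) :
    longJumps k p (T + 1) = longJumps k p T + if T % p < k then 1 else 0 := by
  obtain ⟨q, r, hr, rfl⟩ := exists_eq_mul_add hp T
  rw [longJumps_mul_add q hr, Nat.mul_add_mod, Nat.mod_eq_of_lt hr]
  rcases (show r + 1 ≤ p from hr).lt_or_eq with h | h
  · rw [Nat.add_assoc, longJumps_mul_add q h]
    split_ifs <;> omega
  · have e : p * q + r + 1 = p * (q + 1) + 0 := by rw [← h]; ring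
    rw [e, longJumps_mul_add (q + 1) hp, Nat.mul_succ]
    split_ifs <;> omega

lemma longJumps_mono {k p : ℕ} (hp : 0 < p) (hkp : k ≤ p) : Monotone (longJumps k p) :=
  monotone_nat_of_le_succ fun T => by rw [longJumps_succ hp hkp]; omega

lemma longJumps_of_le {k p i : ℕ} (hp : 0 < p) (hkp : k ≤ p) (hi : i ≤ k) :
    longJumps k p i = i := by
  rcases (hi.trans hkp).lt_or_eq with h | h
  · simpa [hi] using longJumps_mul_add (k := k) 0 h
  · obtain rfl : k = i := by omega
    have := longJumps_mul_add (k := k) 1 hp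
    simpa [← h] using this

lemma le_longJumps_add {k p i : ℕ} (hp : 0 < p) (hkp : k ≤ p) (hi : i ≤ k) (t : ℕ) :
    i ≤ longJumps k p (t + i) := by
  simpa [longJumps_of_le hp hkp hi] using longJumps_mono hp hkp (Nat.le_add_left i t)

/-- The path starting at `i` whose long jumps have size `p + 1` and short jumps have size `1`,
following the `p`-periodic pattern with `k` long jumps shifted by `i`. -/
def periodicPath (k p i t : ℕ) : ℕ := t + i + p * (longJumps k p (t + i) - i)

lemma periodicPath_succ {k p i : ℕ} (hp : 0 < p) (hkp : k ≤ p) (hi : i ≤ k) (t : ℕ) :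
    periodicPath k p i (t + 1) =
      periodicPath k p i t + if (t + i) % p < k then p + 1 else 1 := by
  obtain ⟨d, hd⟩ := Nat.exists_eq_add_of_le (le_longJumps_add hp hkp hi t)
  rw [periodicPath, periodicPath, Nat.add_right_comm t 1 i, longJumps_succ hp hkp, hd,
    Nat.add_assoc i, Nat.add_sub_cancel_left, Nat.add_sub_cancel_left]
  split_ifs <;> ring

lemma periodicPath_strictMono {k p i : ℕ} (hp : 0 < p) (hkp : k ≤ p) (hi : i ≤ k) :
    StrictMono (periodicPath k p i) :=
  strictMono_nat_of_lt_succ fun t => by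
    rw [periodicPath_succ hp hkp hi]
    split_ifs <;> omega

/-- The residue and the quotient modulo `p` of an element of a periodic path. -/
lemma exists_periodicPath_eq {k p i : ℕ} (hp : 0 < p) (hkp : k ≤ p) (hi : i ≤ k) (t : ℕ) :
    ∃ q r y, r < p ∧ t + i = p * q + r ∧ y + i = (k + 1) * q + min r k ∧
      periodicPath k p i t = p * y + r := by
  have hle := le_longJumps_add hp hkp hi t
  obtain ⟨q, r, hr, hT⟩ := exists_eq_mul_add hp (t + i)
  rw [periodicPath]
  rw [hT, longJumps_mul_add q hr] at hle ⊢
  refine ⟨q, r, q + (k * q + min r k - i), hr, rfl, ?_, by ring⟩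
  rw [Nat.succ_mul]
  omega

lemma eq_of_periodicPath_eq {k p i j s t : ℕ} (hp : 0 < p) (hkp : k ≤ p) (hi : i ≤ k)
    (hj : j ≤ k) (h : periodicPath k p i s = periodicPath k p j t) : i = j := by
  obtain ⟨q, r, y, hr, -, hy, hx⟩ := exists_periodicPath_eq hp hkp hi s
  obtain ⟨q', r', y', hr', -, hy', hx'⟩ := exists_periodicPath_eq hp hkp hj t
  rw [hx, hx'] at h
  obtain rfl : r = r' := by
    simpa [Nat.mul_add_mod, Nat.mod_eq_of_lt, hr, hr'] using congrArg (· % p) h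
  obtain rfl : y = y' := Nat.eq_of_mul_eq_mul_left hp (Nat.add_right_cancel h)
  rcases lt_trichotomy q q' with hq | rfl | hq
  · have := Nat.mul_le_mul_left (k + 1) (show q + 1 ≤ q' from hq)
    rw [Nat.mul_succ] at this
    omega
  · omega
  · have := Nat.mul_le_mul_left (k + 1) (show q' + 1 ≤ q from hq)
    rw [Nat.mul_succ] at this
    omega

lemma exists_mem_periodicPath {k p : ℕ} (hp : 0 < p) (hkp : k ≤ p) (x : ℕ) :
    ∃ i ≤ k, ∃ t, periodicPath k p i t = x := by
  obtain ⟨y, r, hr, rfl⟩ := exists_eq_mul_add hp x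
  obtain ⟨q, l, hl, hq⟩ := exists_eq_mul_add k.succ_pos (y + (k - min r k))
  have hiT : k - l ≤ p * q + r := by
    rcases Nat.eq_zero_or_pos q with rfl | hq0
    · omega
    · have := Nat.le_mul_of_pos_right p hq0
      omega
  refine ⟨k - l, by omega, p * q + r - (k - l), ?_⟩
  rw [periodicPath, Nat.sub_add_cancel hiT, longJumps_mul_add q hr]
  have hle := le_longJumps_add hp hkp (Nat.sub_le k l) (p * q + r - (k - l))
  rw [Nat.sub_add_cancel hiT, longJumps_mul_add q hr] at hle
  have hy : y = q + (k * q + min r k - (k - l)) := by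
    rw [Nat.succ_mul] at hq
    omega
  rw [hy]
  ring

lemma periodicPath_bounds {k p i : ℕ} (hp : 0 < p) (hkp : k ≤ p) (hpk : p ≤ 2 * k)
    (hi : i ≤ k) (t : ℕ) :
    (k + 1) * t ≤ periodicPath k p i t + (k + 1) ^ 2 ∧
      periodicPath k p i t ≤ (k + 1) * t + (k + 1) ^ 2 := by
  obtain ⟨q, r, y, hr, hT, hy, hx⟩ := exists_periodicPath_eq hp hkp hi t
  rw [hx]
  zify at *
  have key : (p * y + r : ℤ) = (k + 1) * t + i * (k + 1 - p) + (p * min (r : ℤ) k - k * r) := by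
    linear_combination (p : ℤ) * hy - (k + 1 : ℤ) * hT
  have h1 : 0 ≤ (p * min (r : ℤ) k - k * r) ∧ (p * min (r : ℤ) k - k * r) ≤ k * (p - k) := by
    rcases le_total (r : ℤ) k with h | h
    · rw [min_eq_left h]
      constructor <;> nlinarith
    · rw [min_eq_right h]
      constructor <;> nlinarith
  have h2 : (i * (k + 1 - p) : ℤ) ≤ k := by nlinarith
  have h3 : -(k * k : ℤ) ≤ i * (k + 1 - p) := by nlinarith
  have h4 : (k * (p - k) : ℤ) ≤ k * k := by nlinarith
  constructor <;> nlinarith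

/-- The number of values below `K` of a strictly increasing sequence is the least index at which
the sequence is at least `K`. -/
lemma exists_ncard_range_inter_Iio {u : ℕ → ℕ} (hu : StrictMono u) (K : ℕ) :
    ∃ c, (range u ∩ Iio K).ncard = c ∧ K ≤ u c ∧ ∀ t < c, u t < K := by
  classical
  have hex : ∃ c, K ≤ u c := ⟨K, hu.le_apply⟩
  refine ⟨Nat.find hex, ?_, Nat.find_spec hex, fun t ht => not_le.1 (Nat.find_min hex ht)⟩
  have himage : range u ∩ Iio K = u '' Iio (Nat.find hex) := by
    ext x
    constructor
    · rintro ⟨⟨t, rfl⟩, ht⟩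
      exact ⟨t, hu.lt_iff_lt.1 (lt_of_lt_of_le ht (Nat.find_spec hex)), rfl⟩
    · rintro ⟨t, ht, rfl⟩
      exact ⟨⟨t, rfl⟩, not_le.1 (Nat.find_min hex ht)⟩
  rw [himage, ncard_image_of_injective _ hu.injective, ← Finset.coe_Iio, ncard_coe_finset,
    Nat.card_Iio]

/-- A strictly increasing sequence within distance `n ^ 2` of `t ↦ n * t` has counting function
within `2 * n` of `K / n`. -/
lemma ncard_range_inter_Iio_bounds {u : ℕ → ℕ} {n : ℕ} (hu : StrictMono u) (hn : 0 < n)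
    (hb : ∀ t, n * t ≤ u t + n ^ 2 ∧ u t ≤ n * t + n ^ 2) (K : ℕ) :
    (K : ℝ) / n - 2 * n ≤ ((range u ∩ Iio K).ncard : ℝ) ∧
      ((range u ∩ Iio K).ncard : ℝ) ≤ (K : ℝ) / n + 2 * n := by
  obtain ⟨c, hc, hK, hlt⟩ := exists_ncard_range_inter_Iio hu K
  have hlower : K ≤ (c + 2 * n) * n := by nlinarith [(hb c).2]
  have hupper : c * n ≤ K + 2 * n * n := by
    rcases c with _ | t
    · simp
    · nlinarith [(hb t).1, hlt t t.lt_succ_self]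
  have hn' : (0 : ℝ) < n := by exact_mod_cast hn
  rw [hc, sub_le_iff_le_add, div_le_iff₀ hn', ← sub_le_iff_le_add, le_div_iff₀ hn', sub_mul,
    sub_le_iff_le_add]
  exact ⟨by exact_mod_cast hlower, by exact_mod_cast hupper⟩

/-- For `n ≤ m ≤ 2n - 1` with `n ≥ 2`, `ℕ₀` can be partitioned into `n` infinite
subsets (paths), given by their strictly increasing enumerations `u i`, each of
whose sequences of successive jumps is, up to a shift of the pattern, the
periodic repetition of `n - 1` jumps of size `m` followed by `m - n` jumps of
size `1`; moreover, the number of elements of each path inside `{0, …, K-1}`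
lies between `K/n - 2n` and `K/n + 2n` for every `K ≥ 1`. -/
theorem partition_into_periodic_paths (n m : ℕ) (hn : 2 ≤ n)
    (hnm : n ≤ m) (hm : m ≤ 2 * n - 1) :
    ∃ u : Fin n → ℕ → ℕ,
      (∀ i, StrictMono (u i)) ∧
      (∀ i, (Set.range (u i)).Infinite) ∧
      (∀ i j, i ≠ j → Disjoint (Set.range (u i)) (Set.range (u j))) ∧
      (⋃ i, Set.range (u i)) = Set.univ ∧
      (∀ i, ∃ s : ℕ, ∀ t : ℕ,
        u i (t + 1) = u i t + (if (t + s) % (m - 1) < n - 1 then m else 1)) ∧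
      (∀ K : ℕ, 1 ≤ K → ∀ i,
        (K : ℝ) / (n : ℝ) - 2 * (n : ℝ) ≤
            ((Set.range (u i) ∩ Set.Iio K).ncard : ℝ) ∧
          ((Set.range (u i) ∩ Set.Iio K).ncard : ℝ) ≤
            (K : ℝ) / (n : ℝ) + 2 * (n : ℝ)) := by
  obtain ⟨k, rfl⟩ : ∃ k, n = k + 1 := ⟨n - 1, by omega⟩
  obtain ⟨p, rfl⟩ : ∃ p, m = p + 1 := ⟨m - 1, by omega⟩
  have hp : 0 < p := by omega
  have hkp : k ≤ p := by omega
  have hi (i : Fin (k + 1)) : (i : ℕ) ≤ k := Nat.le_of_lt_succ i.isLt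
  have hmono (i : Fin (k + 1)) := periodicPath_strictMono hp hkp (hi i)
  refine ⟨fun i => periodicPath k p i, hmono, fun i => infinite_range_of_injective
    (hmono i).injective, ?_, ?_, fun i => ⟨i, fun t => periodicPath_succ hp hkp (hi i) t⟩,
    fun K _ i => ncard_range_inter_Iio_bounds (hmono i) k.succ_pos
      (periodicPath_bounds hp hkp (by omega) (hi i)) K⟩
  · intro i j hij
    rw [Set.disjoint_left]
    rintro _ ⟨s, rfl⟩ ⟨t, h⟩
    exact hij (Fin.ext (eq_of_periodicPath_eq hp hkp (hi j) (hi i) h).symm)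
  · refine eq_univ_of_forall fun x => ?_
    obtain ⟨i, hik, t, rfl⟩ := exists_mem_periodicPath hp hkp x
    exact mem_iUnion.2 ⟨⟨i, Nat.lt_succ_of_le hik⟩, t, rfl⟩
end

section
/- Let p ≥ q > 1 be real numbers and let α be a real number with 0 < α < 1 and α ≤ 1/p + 1/q. Then there exists a constant C > 0 such that for all real numbers x and y, (|x| + 1)^{p−1} · (|y| + 1)^{q−1} ≤ C · (|x|^p + |y|^q + 1)^{2−α}. -/
/-- If `t ^ r ≤ S` and `1 ≤ S`, then `(t + 1) ^ (r - 1)` is at most a constant times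
`S ^ (1 - 1 / r)`. -/
theorem Real.add_one_rpow_sub_one_le {r t S : ℝ} (hr : 1 ≤ r) (ht : 0 ≤ t) (hS : 1 ≤ S)
    (htS : t ^ r ≤ S) : (t + 1) ^ (r - 1) ≤ 2 ^ (r - 1) * S ^ (1 - 1 / r) := by
  have hr0 : 0 < r := by linarith
  have hS0 : 0 ≤ S := by linarith
  have ht' : t ≤ S ^ (1 / r) := by
    rw [one_div]
    exact (Real.le_rpow_inv_iff_of_pos ht hS0 hr0).2 htS
  have h1 : 1 ≤ S ^ (1 / r) := Real.one_le_rpow hS (by positivity)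
  calc (t + 1) ^ (r - 1) ≤ (2 * S ^ (1 / r)) ^ (r - 1) :=
        Real.rpow_le_rpow (by linarith) (by linarith) (by linarith)
    _ = 2 ^ (r - 1) * S ^ (1 - 1 / r) := by
        rw [Real.mul_rpow (by norm_num) (by positivity), ← Real.rpow_mul hS0]
        congr 2
        field_simp

/-- The key uniform estimate for the Hölder quotient of the derivative of the
generator `f_1`: for `p ≥ q > 1` and `0 < α < 1` with `α ≤ 1/p + 1/q`, there
is a constant `C > 0` with
`(|x|+1)^{p-1} (|y|+1)^{q-1} ≤ C (|x|^p + |y|^q + 1)^{2-α}` for all `x, y`. -/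
theorem uniform_holder_estimate (p q α : ℝ) (hq : 1 < q) (hpq : q ≤ p)
    (hα0 : 0 < α) (hα1 : α < 1) (hαpq : α ≤ 1 / p + 1 / q) :
    ∃ C : ℝ, 0 < C ∧ ∀ x y : ℝ,
      (|x| + 1) ^ (p - 1) * (|y| + 1) ^ (q - 1) ≤
        C * (|x| ^ p + |y| ^ q + 1) ^ (2 - α) := by
  refine ⟨2 ^ (p - 1) * 2 ^ (q - 1), by positivity, fun x y => ?_⟩
  have hx : 0 ≤ |x| ^ p := by positivity
  have hy : 0 ≤ |y| ^ q := by positivity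
  set S := |x| ^ p + |y| ^ q + 1 with hS
  have hS1 : 1 ≤ S := by linarith
  have hxS := Real.add_one_rpow_sub_one_le (hq.le.trans hpq) (abs_nonneg x) hS1
    (by linarith : |x| ^ p ≤ S)
  have hyS := Real.add_one_rpow_sub_one_le hq.le (abs_nonneg y) hS1
    (by linarith : |y| ^ q ≤ S)
  calc (|x| + 1) ^ (p - 1) * (|y| + 1) ^ (q - 1)
      ≤ (2 ^ (p - 1) * S ^ (1 - 1 / p)) * (2 ^ (q - 1) * S ^ (1 - 1 / q)) :=
        mul_le_mul hxS hyS (by positivity) (by positivity)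
    _ = 2 ^ (p - 1) * 2 ^ (q - 1) * S ^ ((1 - 1 / p) + (1 - 1 / q)) := by
        rw [Real.rpow_add (by linarith)]
        ring
    _ ≤ 2 ^ (p - 1) * 2 ^ (q - 1) * S ^ (2 - α) := by
        gcongr
        linarith
end

section
/- Let P be a real number with 1 < P ≤ 2, let S ≥ 1 be a real number, and set T := S^{1/P}. Then for all integers a ≥ 0 and b ≥ a + 2, the following lower bound holds: ∑_{j=a+1}^{b−1} 1/(S + j^P) ≥ (b − a − 1) / ((a + 1 + T)^{P−1} · (b + T)). -/
open Finset

lemma add_rpow_le_add_rpow_inv_rpow {P S x : ℝ} (hP : 1 ≤ P) (hS : 0 ≤ S) (hx : 0 ≤ x) :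
    S + x ^ P ≤ (x + S ^ (1 / P)) ^ P := by
  have hT : (S ^ (1 / P)) ^ P = S := by
    rw [← Real.rpow_mul hS, one_div_mul_cancel (by linarith), Real.rpow_one]
  have h := Real.add_rpow_le_rpow_add hx (Real.rpow_nonneg hS (1 / P)) hP
  linarith

lemma mul_rpow_le_rpow_mul_of_le {A B s : ℝ} (hA : 0 < A) (hAB : A ≤ B) (hs : s ≤ 1) :
    A * B ^ s ≤ A ^ s * B := by
  have hB : 0 < B := hA.trans_le hAB
  have split : ∀ {x : ℝ}, 0 < x → x = x ^ s * x ^ (1 - s) := fun hx => by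
    rw [← Real.rpow_add hx, add_sub_cancel, Real.rpow_one]
  calc A * B ^ s = A ^ s * A ^ (1 - s) * B ^ s := by rw [← split hA]
    _ ≤ A ^ s * B ^ (1 - s) * B ^ s := by gcongr
    _ = A ^ s * (B ^ s * B ^ (1 - s)) := by ring
    _ = A ^ s * B := by rw [← split hB]

lemma div_rpow_mul_succ_le {A B P : ℝ} (hA : 0 < A) (hAB : A ≤ B) (hP : P ≤ 2) :
    (B + 1 - A) / (A ^ (P - 1) * (B + 1)) ≤ (B - A) / (A ^ (P - 1) * B) + 1 / B ^ P := by
  have hB : 0 < B := hA.trans_le hAB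
  have hBP : B ^ P = B ^ (P - 1) * B := by
    rw [Real.rpow_sub_one hB.ne', div_mul_cancel₀ _ hB.ne']
  have h := mul_rpow_le_rpow_mul_of_le hA hAB (by linarith : P - 1 ≤ 1)
  have hp : 0 < A ^ (P - 1) := Real.rpow_pos_of_pos hA _
  have hq : 0 < B ^ (P - 1) := Real.rpow_pos_of_pos hB _
  rw [hBP]
  generalize A ^ (P - 1) = p at *
  generalize B ^ (P - 1) = q at *
  rw [← sub_nonneg]
  have key : (B - A) / (p * B) + 1 / (q * B) - (B + 1 - A) / (p * (B + 1)) =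
      (p * (B + 1) - A * q) / (p * q * B * (B + 1)) := by
    field_simp
    ring
  rw [key]
  apply div_nonneg
  · linarith
  · positivity

/-- The distance estimate: for `1 < P ≤ 2`, `S ≥ 1`, `T = S^{1/P}` and integers
`b ≥ a + 2`, one has
`∑_{j=a+1}^{b-1} 1/(S + j^P) ≥ (b - a - 1)/((a + 1 + T)^{P-1} (b + T))`. -/
theorem sum_lengths_lower_bound (P S : ℝ) (hP1 : 1 < P) (hP2 : P ≤ 2)
    (hS : 1 ≤ S) (a b : ℕ) (hab : a + 2 ≤ b) :
    ((b : ℝ) - (a : ℝ) - 1) /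
        (((a : ℝ) + 1 + S ^ (1 / P)) ^ (P - 1) * ((b : ℝ) + S ^ (1 / P))) ≤
      ∑ j ∈ Finset.Ico (a + 1) b, 1 / (S + (j : ℝ) ^ P) := by
  have hab' : a + 1 ≤ b := by omega
  clear hab
  induction b, hab' using Nat.le_induction with
  | base => simp
  | succ b hb ih =>
    rw [Finset.sum_Ico_succ_top hb]
    have hT : 0 < S ^ (1 / P) := Real.rpow_pos_of_pos (by linarith) _
    have hab : (a : ℝ) + 1 ≤ b := by exact_mod_cast hb
    have hterm : 1 / ((b : ℝ) + S ^ (1 / P)) ^ P ≤ 1 / (S + (b : ℝ) ^ P) :=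
      one_div_le_one_div_of_le (by positivity)
        (add_rpow_le_add_rpow_inv_rpow hP1.le (by linarith) b.cast_nonneg)
    have hstep := div_rpow_mul_succ_le (A := a + 1 + S ^ (1 / P)) (B := b + S ^ (1 / P))
      (by positivity) (by linarith) hP2
    generalize S ^ (1 / P) = T at *
    rw [show (b : ℝ) + T + 1 - (a + 1 + T) = (b + 1 : ℕ) - a - 1 by push_cast; ring,
      show (b : ℝ) + T + 1 = (b + 1 : ℕ) + T by push_cast; ring,
      show (b : ℝ) + T - (a + 1 + T) = b - a - 1 by ring] at hstep
    linarith
end
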